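/- Let I be a finite subset of {1,…,n} and let j be an integer with 1 ≤ j ≤ |I| − 1. For x ∈ {0,1}^n define P^j(x) = ∑_{i<i', i,i'∈I} xᵢx_{i'} − j·∑_{i∈I} xᵢ + j(j+1)/2. Then for every x ∈ {0,1}^n: P^j(x) = 0 if j ≤ ∑_{i∈I} xᵢ ≤ j+1, and P^j(x) > 0 otherwise. -/

import Mathlib

theorem pair_sum_aux (n : ℕ) (I : Finset (Fin n)) (x : Fin n → ℝ) (hx : ∀ i, x i = 0 ∨ x i = 1) :
    2 * (∑ i ∈ I, ∑ i' ∈ I.filter (fun i' => i < i'), x i * x i') =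
      (∑ i ∈ I, x i) * (∑ i ∈ I, x i) - ∑ i ∈ I, x i := by
  have h1 : (∑ i ∈ I, ∑ i' ∈ I.filter (fun i' => i < i'), x i * x i') =
      ∑ i ∈ I, ∑ k ∈ I, if i < k then x i * x k else 0 := by
    simp only [Finset.sum_filter]
  have h2 : (∑ i ∈ I, ∑ k ∈ I, if i < k then x i * x k else 0) =
      ∑ i ∈ I, ∑ k ∈ I, if k < i then x i * x k else 0 := by
    rw [Finset.sum_comm]
    simp only [mul_comm]
  have h3 : ∑ i ∈ I, x i = ∑ i ∈ I, ∑ k ∈ I, if i = k then x i * x k else 0 := by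
    refine Finset.sum_congr rfl fun i hi => ?_
    rw [Finset.sum_ite_eq, if_pos hi]
    rcases hx i with h | h <;> simp [h]
  have h4 : (∑ i ∈ I, x i) * (∑ i ∈ I, x i) =
      (∑ i ∈ I, ∑ k ∈ I, if i < k then x i * x k else 0) +
      (∑ i ∈ I, ∑ k ∈ I, if k < i then x i * x k else 0) +
      (∑ i ∈ I, ∑ k ∈ I, if i = k then x i * x k else 0) := by
    rw [Finset.sum_mul_sum]
    simp only [← Finset.sum_add_distrib]
    refine Finset.sum_congr rfl fun i _ => Finset.sum_congr rfl fun k _ => ?_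
    rcases lt_trichotomy i k with h | h | h
    · simp [h, h.not_gt, h.ne]
    · simp [h]
    · simp [h, h.not_gt, h.ne']
  rw [← h3, ← h2, ← h1] at h4
  linarith

theorem int_sum_aux (n : ℕ) (I : Finset (Fin n)) (x : Fin n → ℝ) (hx : ∀ i, x i = 0 ∨ x i = 1) :
    ∃ m : ℤ, ∑ i ∈ I, x i = (m : ℝ) := by
  refine ⟨∑ i ∈ I, if x i = 1 then 1 else 0, ?_⟩
  push_cast
  refine Finset.sum_congr rfl fun i _ => ?_
  rcases hx i with h | h <;> simp [h]

theorem stmt_10 (n : ℕ) (I : Finset (Fin n))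
    (j : ℤ) (hjl : 1 ≤ j) (hju : j ≤ (I.card : ℤ) - 1)
    (x : Fin n → ℝ) (hx : ∀ i, x i = 0 ∨ x i = 1) :
    (((j : ℝ) ≤ (∑ i ∈ I, x i) ∧ (∑ i ∈ I, x i) ≤ (j : ℝ) + 1) →
      (∑ i ∈ I, ∑ i' ∈ I.filter (fun i' => i < i'), x i * x i') -
        (j : ℝ) * (∑ i ∈ I, x i) + (j : ℝ) * ((j : ℝ) + 1) / 2 = 0) ∧
    (¬ ((j : ℝ) ≤ (∑ i ∈ I, x i) ∧ (∑ i ∈ I, x i) ≤ (j : ℝ) + 1) →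
      0 < (∑ i ∈ I, ∑ i' ∈ I.filter (fun i' => i < i'), x i * x i') -
        (j : ℝ) * (∑ i ∈ I, x i) + (j : ℝ) * ((j : ℝ) + 1) / 2) := by
  have hp := pair_sum_aux n I x hx
  obtain ⟨m, hm⟩ := int_sum_aux n I x hx
  rw [hm] at hp ⊢
  generalize (∑ i ∈ I, ∑ i' ∈ I.filter (fun i' => i < i'), x i * x i') = Q at hp ⊢
  have key : Q - (j : ℝ) * m + (j : ℝ) * ((j : ℝ) + 1) / 2 = ((m - j) * (m - j - 1) : ℝ) / 2 := by
    linarith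
  rw [key]
  constructor
  · rintro ⟨h1, h2⟩
    have h1' : j ≤ m := by exact_mod_cast h1
    have h2' : m ≤ j + 1 := by exact_mod_cast h2
    obtain h | h : m = j ∨ m = j + 1 := by omega
    · simp [h]
    · simp [h]
  · intro h
    rw [not_and_or, not_le, not_le] at h
    rcases h with h | h <;> nlinarith
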